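/- Fix k ≥ 1 and ℓ ≥ 1, and set m = max(k,ℓ). For n ≥ 0 let a_n be the number of permutations of length n that avoid the classical pattern 1-3-2, begin with the pattern 12⋯k, and end with the pattern 12⋯ℓ. Then in the ring of formal power series with integer coefficients, ∑_{n≥0} a_n x^n = x^{k+ℓ-1} · C(x)^{ℓ+1} + ∑_{n=m}^{k+ℓ-2} x^n (the last sum being empty when m > k+ℓ-2). -/

import Mathlib

/-- `π` avoids the classical pattern 1-3-2: there are no indices `i < j < k`
with `π i < π k < π j`. -/
def AvoidsC132 {n : ℕ} (π : Equiv.Perm (Fin n)) : Prop :=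
  ¬ ∃ i j k : Fin n, i < j ∧ j < k ∧ π i < π k ∧ π k < π j

/-- `π` begins with the pattern `12⋯k`: its first `k` letters are increasing
(in particular the length is at least `k`). -/
def BeginsInc {n : ℕ} (π : Equiv.Perm (Fin n)) (k : ℕ) : Prop :=
  k ≤ n ∧ ∀ i j : Fin n, i < j → (j : ℕ) < k → π i < π j

/-- `π` ends with the pattern `12⋯ℓ`: its last `ℓ` letters are increasing
(in particular the length is at least `ℓ`). -/
def EndsInc {n : ℕ} (π : Equiv.Perm (Fin n)) (l : ℕ) : Prop :=
  l ≤ n ∧ ∀ i j : Fin n, i < j → n - l ≤ (i : ℕ) → π i < π j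

/-- The number of permutations of length `n` avoiding the classical pattern 1-3-2,
beginning with `12⋯k` and ending with `12⋯ℓ`. -/
noncomputable def a (k l n : ℕ) : ℕ :=
  Nat.card {π : Equiv.Perm (Fin n) // AvoidsC132 π ∧ BeginsInc π k ∧ EndsInc π l}

namespace P132

/-- insert value v at position p -/
def ins {n : ℕ} (p v : Fin (n+1)) (σ : Equiv.Perm (Fin n)) : Equiv.Perm (Fin (n+1)) :=
  (finSuccEquiv' p).trans ((Equiv.optionCongr σ).trans (finSuccEquiv' v).symm)

lemma ins_self {n : ℕ} (p v : Fin (n+1)) (σ : Equiv.Perm (Fin n)) : ins p v σ p = v := by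
  simp [ins]

lemma ins_succAbove {n : ℕ} (p v : Fin (n+1)) (σ : Equiv.Perm (Fin n)) (i : Fin n) :
    ins p v σ (p.succAbove i) = v.succAbove (σ i) := by
  simp [ins]

lemma ins_surj {n : ℕ} (p : Fin (n+1)) (π : Equiv.Perm (Fin (n+1))) :
    ∃ σ, π = ins p (π p) σ := by
  let e : Option (Fin n) ≃ Option (Fin n) :=
    (finSuccEquiv' p).symm.trans (π.trans (finSuccEquiv' (π p)))
  have he : e none = none := by simp [e]
  refine ⟨Equiv.removeNone e, ?_⟩
  ext x
  rcases Fin.eq_self_or_eq_succAbove p x with rfl | ⟨j, rfl⟩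
  · rw [ins_self]
  · rw [ins_succAbove]
    have h1 : some (Equiv.removeNone e j) = e (some j) := by
      apply Equiv.removeNone_some
      rw [← Option.isSome_iff_exists, Option.isSome_iff_ne_none, ← he]
      intro hh
      simpa using e.injective hh
    have h2 : finSuccEquiv' (π p) (π (p.succAbove j)) = some (Equiv.removeNone e j) := by
      rw [h1]; simp [e]
    have h3 := congrArg (finSuccEquiv' (π p)).symm h2
    simp at h3
    rw [← h3]

lemma card_ins {n : ℕ} (p : Fin (n+1)) (vf : Equiv.Perm (Fin n) → Fin (n+1))
    (P : Equiv.Perm (Fin n) → Prop) (Q : Equiv.Perm (Fin (n+1)) → Prop)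
    (h1 : ∀ σ, P σ → Q (ins p (vf σ) σ))
    (h2 : ∀ v σ, Q (ins p v σ) → v = vf σ ∧ P σ) :
    Nat.card {π // Q π} = Nat.card {σ // P σ} := by
  symm
  refine Nat.card_congr (Equiv.ofBijective
    (fun s : {σ // P σ} => (⟨ins p (vf s.1) s.1, h1 _ s.2⟩ : {π // Q π})) ⟨?_, ?_⟩)
  · rintro ⟨s, hs⟩ ⟨t, ht⟩ h
    simp only [Subtype.mk.injEq] at h ⊢
    have hv : vf s = vf t := by
      have := congrArg (fun π : Equiv.Perm (Fin (n+1)) => π p) h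
      simpa [ins_self] using this
    ext i
    have := congrArg (fun π : Equiv.Perm (Fin (n+1)) => π (p.succAbove i)) h
    simp only [ins_succAbove, hv] at this
    rw [Fin.succAbove_right_injective this]
  · rintro ⟨π, hπ⟩
    obtain ⟨σ, hσ⟩ := ins_surj p π
    rw [hσ] at hπ
    obtain ⟨hv, hP⟩ := h2 _ _ hπ
    refine ⟨⟨σ, hP⟩, ?_⟩
    simp only [Subtype.mk.injEq]
    rw [← hv, ← hσ]

lemma avoids_of_ins {n : ℕ} {p v : Fin (n+1)} {σ : Equiv.Perm (Fin n)}
    (h : AvoidsC132 (ins p v σ)) : AvoidsC132 σ := by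
  rintro ⟨i, j, k, hij, hjk, h1, h2⟩
  refine h ⟨p.succAbove i, p.succAbove j, p.succAbove k, ?_, ?_, ?_, ?_⟩
  all_goals simpa [ins_succAbove]

lemma sA_lt {n : ℕ} (v : Fin (n+1)) (x y : Fin n) : v.succAbove x < v.succAbove y ↔ x < y := by
  simp

lemma lt_of_endsInc {n l : ℕ} {π : Equiv.Perm (Fin n)} (h : EndsInc π l) : l ≤ n := h.1

/-- B1 -/
lemma a_succ (k l m : ℕ) (hk : 1 ≤ k) (hl : l ≤ m + 1) :
    a (k+1) l (m+2) = a k l (m+1) := by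
  unfold a
  refine card_ins 0 (fun σ => (σ 0).castSucc) _ _ ?_ ?_
  · rintro σ ⟨ha, hb, he⟩
    have key : ∀ i : Fin (m+1), (ins 0 (σ 0).castSucc σ) i.succ = (σ 0).castSucc.succAbove (σ i) := by
      intro i
      have := ins_succAbove 0 (σ 0).castSucc σ i
      rwa [Fin.succAbove_zero] at this
    have key0 := ins_self 0 (σ 0).castSucc σ
    have lt0 : ∀ i : Fin (m+1), (σ 0).castSucc < (σ 0).castSucc.succAbove (σ i) ↔ σ 0 ≤ σ i := by
      intro i
      rw [Fin.lt_succAbove_iff_le_castSucc]; simp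
    refine ⟨?_, ⟨by have := hb.1; omega, ?_⟩, ⟨by omega, ?_⟩⟩
    · rintro ⟨i, j, r, hij, hjr, h1, h2⟩
      obtain ⟨j, rfl⟩ := Fin.exists_succ_eq.2 (Fin.ne_zero_of_lt hij)
      obtain ⟨r, rfl⟩ := Fin.exists_succ_eq.2 (Fin.ne_zero_of_lt hjr)
      rw [Fin.succ_lt_succ_iff] at hjr
      rw [key, key, sA_lt] at h2
      induction i using Fin.cases with
      | zero =>
        rw [key0, key, lt0] at h1
        have hr : r ≠ 0 := Fin.ne_zero_of_lt hjr
        have h1' : σ 0 < σ r := lt_of_le_of_ne h1 (fun h => hr (σ.injective h).symm)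
        have hj : j ≠ 0 := by rintro rfl; exact absurd h1 (not_le.2 h2)
        exact ha ⟨0, j, r, Fin.pos_of_ne_zero hj, hjr, h1', h2⟩
      | succ i =>
        rw [key, key, sA_lt] at h1
        exact ha ⟨i, j, r, by simpa using hij, hjr, h1, h2⟩
    · intro i j hij hj
      obtain ⟨j, rfl⟩ := Fin.exists_succ_eq.2 (Fin.ne_zero_of_lt hij)
      have hj' : (j : ℕ) < k := by simpa using hj
      induction i using Fin.cases with
      | zero =>
        rw [key0, key, lt0]
        by_cases h : j = 0
        · simp [h]
        · exact (hb.2 0 j (Fin.pos_of_ne_zero h) hj').le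
      | succ i =>
        rw [key, key, sA_lt]
        exact hb.2 i j (by simpa using hij) hj'
    · intro i j hij hi
      obtain ⟨j, rfl⟩ := Fin.exists_succ_eq.2 (Fin.ne_zero_of_lt hij)
      induction i using Fin.cases with
      | zero => simp at hi; omega
      | succ i =>
        rw [key, key, sA_lt]
        refine he.2 i j (by simpa using hij) ?_
        simp at hi; omega
  · rintro v σ ⟨ha, hb, he⟩
    have key : ∀ i : Fin (m+1), (ins 0 v σ) i.succ = v.succAbove (σ i) := by
      intro i
      have := ins_succAbove 0 v σ i
      rwa [Fin.succAbove_zero] at this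
    have key0 := ins_self 0 v σ
    refine ⟨?_, avoids_of_ins ha, ⟨by have := hb.1; omega, ?_⟩, ⟨by omega, ?_⟩⟩
    · have h1 : v < v.succAbove (σ 0) := by
        rw [← key]
        nth_rw 1 [← key0]
        exact hb.2 _ _ (Fin.succ_pos _) (by simp; omega)
      by_contra hne
      rw [Fin.lt_succAbove_iff_le_castSucc] at h1
      have h2 : v < (σ 0).castSucc := lt_of_le_of_ne h1 hne
      obtain ⟨q, hq⟩ := (ins 0 v σ).surjective (σ 0).castSucc
      have hs : v.succAbove (σ 0) = (σ 0).succ := Fin.succAbove_of_le_castSucc _ _ h1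
      have hq0 : q ≠ 0 := by rintro rfl; rw [key0] at hq; exact hne hq
      obtain ⟨r, rfl⟩ := Fin.exists_succ_eq.2 hq0
      have hr : r ≠ 0 := by
        rintro rfl
        rw [key, hs] at hq
        have := congrArg Fin.val hq
        simp at this
      refine ha ⟨0, (0 : Fin (m+1)).succ, r.succ, Fin.succ_pos _, ?_, ?_, ?_⟩
      · exact Fin.succ_lt_succ_iff.2 (Fin.pos_of_ne_zero hr)
      · rw [key0, hq]; exact h2
      · rw [hq, key, hs]; exact Fin.castSucc_lt_succ
    · intro i j hij hj
      have := hb.2 i.succ j.succ (by simpa using hij) (by simpa using hj)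
      rwa [key, key, sA_lt] at this
    · intro i j hij hi
      have := he.2 i.succ j.succ (by simpa using hij) (by simp; omega)
      rwa [key, key, sA_lt] at this

/-- avoiders ending with 12..l -/
noncomputable def e (l n : ℕ) : ℕ :=
  Nat.card {π : Equiv.Perm (Fin n) // AvoidsC132 π ∧ EndsInc π l}

lemma e_exact (l n : ℕ) (h : l ≤ n) :
    Nat.card {π : Equiv.Perm (Fin (n+1)) // AvoidsC132 π ∧ EndsInc π (l+1) ∧ ¬ EndsInc π (l+2)}
      = e l n := by
  unfold e
  let p : Fin (n+1) := ⟨n - l, by omega⟩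
  have hp : (p : ℕ) = n - l := rfl
  refine card_ins p (fun _ => 0) _ _ ?_ ?_
  · rintro σ ⟨ha, he⟩
    have key := ins_succAbove p 0 σ
    have key0 := ins_self p 0 σ
    have hpos : ∀ x, x ≠ p → 0 < ins p 0 σ x := by
      intro x hx
      refine Fin.pos_of_ne_zero fun h => hx ?_
      exact (ins p 0 σ).injective (h.trans key0.symm)
    have inc : ∀ i j : Fin (n+1), i < j → (p : ℕ) ≤ i → ins p 0 σ i < ins p 0 σ j := by
      intro i j hij hi
      rcases Fin.eq_self_or_eq_succAbove p j with rfl | ⟨j, rfl⟩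
      · exact absurd hij (not_lt.2 hi)
      rcases Fin.eq_self_or_eq_succAbove p i with rfl | ⟨i, rfl⟩
      · rw [key0]; exact hpos _ (ne_of_gt hij)
      · rw [key, key, sA_lt]
        rw [sA_lt] at hij
        refine he.2 i j hij ?_
        have h1 : p ≤ i.castSucc := by
          by_contra hc
          rw [Fin.succAbove_of_castSucc_lt _ _ (not_le.1 hc)] at hi
          exact hc hi
        exact h1
    refine ⟨?_, ⟨by omega, ?_⟩, ?_⟩
    · rintro ⟨i, j, r, hij, hjr, h1, h2⟩
      rcases Fin.eq_self_or_eq_succAbove p j with rfl | ⟨j, rfl⟩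
      · rw [key0] at h2; simp at h2
      rcases Fin.eq_self_or_eq_succAbove p r with rfl | ⟨r, rfl⟩
      · rw [key0] at h1; simp at h1
      rcases Fin.eq_self_or_eq_succAbove p i with rfl | ⟨i, rfl⟩
      · exact absurd (inc _ _ hjr (le_of_lt hij)) (not_lt.2 h2.le)
      · rw [sA_lt] at hij hjr
        rw [key, key, sA_lt] at h1 h2
        exact ha ⟨i, j, r, hij, hjr, h1, h2⟩
    · intro i j hij hi
      exact inc i j hij (by omega)
    · rintro ⟨hn, h2⟩
      have := h2 ⟨n - l - 1, by omega⟩ p (by rw [Fin.lt_def]; simp; omega) (by simp; omega)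
      rw [key0] at this
      simp at this
  · rintro v σ ⟨ha, he, hne⟩
    have key := ins_succAbove p v σ
    have key0 := ins_self p v σ
    refine ⟨?_, avoids_of_ins ha, ⟨by omega, ?_⟩⟩
    · by_contra hv
      obtain ⟨x, hx⟩ := (ins p v σ).surjective 0
      have hxv : ins p v σ x < ins p v σ p := by rw [hx, key0]; exact Fin.pos_of_ne_zero hv
      have hxp : x < p := by
        rcases lt_trichotomy x p with h | h | h
        · exact h
        · rw [h] at hxv; exact absurd hxv (lt_irrefl _)
        · exact absurd (he.2 p x h (by omega)) (not_lt.2 hxv.le)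
      have hxn : (x : ℕ) < n - l := hxp
      let b : Fin (n+1) := ⟨n - l - 1, by omega⟩
      have hb : (b : ℕ) = n - l - 1 := rfl
      have hbp : b < p := by rw [Fin.lt_def]; omega
      by_cases hlt : ins p v σ b < ins p v σ p
      · refine hne ⟨by omega, fun i j hij hi => ?_⟩
        have hij' : (i : ℕ) < j := hij
        by_cases hib : i = b
        · subst hib
          rcases eq_or_ne j p with rfl | hjp
          · exact hlt
          · have : (j : ℕ) ≠ p := fun h => hjp (Fin.ext h)
            exact hlt.trans (he.2 p j (by rw [Fin.lt_def]; omega) (by omega))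
        · have : (i : ℕ) ≠ b := fun h => hib (Fin.ext h)
          exact he.2 i j hij (by omega)
      · have hgt : ins p v σ p < ins p v σ b :=
          lt_of_le_of_ne (not_lt.1 hlt) (fun h => (ne_of_gt hbp) ((ins p v σ).injective h))
        have hxb : x ≠ b := by intro hh; rw [hh] at hxv; exact hlt hxv
        have : (x : ℕ) ≠ b := fun h => hxb (Fin.ext h)
        exact ha ⟨x, b, p, by rw [Fin.lt_def]; omega, hbp, hxv, hgt⟩
    · intro i j hij hi
      have := he.2 (p.succAbove i) (p.succAbove j) (by simpa using hij) (by
        have : p ≤ i.castSucc := by rw [Fin.le_def]; simpa [hp] using hi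
        rw [Fin.succAbove_of_le_castSucc _ _ this]
        simp; omega)
      rwa [key, key, sA_lt] at this

lemma EndsInc.mono {n l : ℕ} {π : Equiv.Perm (Fin n)} (h : EndsInc π (l+1)) : EndsInc π l :=
  ⟨by have := h.1; omega, fun i j hij hi => h.2 i j hij (by omega)⟩

lemma e_rec (l n : ℕ) (h : l ≤ n) : e (l+1) (n+1) = e (l+2) (n+1) + e l n := by
  rw [← e_exact l n h]
  unfold e
  classical
  simp only [Nat.card_eq_fintype_card, Fintype.card_subtype]
  rw [← Finset.card_union_of_disjoint]
  · congr 1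
    ext π
    simp only [Finset.mem_filter, Finset.mem_univ, true_and, Finset.mem_union]
    have : EndsInc π (l+2) → EndsInc π (l+1) := EndsInc.mono
    tauto
  · rw [Finset.disjoint_filter]
    tauto

lemma e_zero_of_lt (l n : ℕ) (h : n < l) : e l n = 0 := by
  unfold e
  have : IsEmpty {π : Equiv.Perm (Fin n) // AvoidsC132 π ∧ EndsInc π l} :=
    ⟨fun x => by have := x.2.2.1; omega⟩
  simp

lemma e_zero_zero : e 0 0 = 1 := by
  unfold e
  rw [Nat.card_eq_one_iff_unique]
  refine ⟨⟨fun x y => Subtype.ext (Subsingleton.elim _ _)⟩, ⟨1, ?_, le_refl _, ?_⟩⟩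
  · rintro ⟨i, _⟩; exact i.elim0
  · intro i; exact i.elim0

lemma e_zero_succ (n : ℕ) : e 0 (n+1) = e 1 (n+1) := by
  unfold e
  congr! 4 with π
  constructor
  · intro _
    refine ⟨by omega, fun i j hij hi => ?_⟩
    have : (i : ℕ) < j := hij
    omega
  · exact EndsInc.mono

open PowerSeries in
/-- Catalan series over the integers -/
noncomputable def CC : PowerSeries ℤ := PowerSeries.mk fun n => (catalan n : ℤ)

open PowerSeries in
lemma CC_eq : CC = 1 + X * CC ^ 2 := by
  ext n
  cases n with
  | zero => simp [CC]
  | succ n =>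
    rw [map_add, coeff_succ_X_mul, sq, coeff_mul]
    simp [CC, catalan_succ', coeff_one]

open PowerSeries in
lemma e_eq (n : ℕ) : ∀ l, (e l n : ℤ) = coeff n (X ^ l * CC ^ (l+1)) := by
  have z : ∀ l n, n < l → (e l n : ℤ) = coeff n (X ^ l * CC ^ (l+1)) := by
    intro l n h
    rw [e_zero_of_lt l n h, coeff_X_pow_mul', if_neg (by omega)]; simp
  induction n with
  | zero =>
    intro l
    rcases Nat.eq_zero_or_pos l with rfl | hl
    · simp [e_zero_zero, CC]
    · exact z _ _ hl
  | succ n ih =>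
    have main : ∀ d l, n + 1 ≤ l + d → (e (l+1) (n+1) : ℤ) = coeff (n+1) (X ^ (l+1) * CC ^ (l+2)) := by
      intro d
      induction d with
      | zero => intro l h; exact z _ _ (by omega)
      | succ d ihd =>
        intro l h
        by_cases hl : l ≤ n
        · have id1 : (X ^ (l+1) * CC ^ (l+2) : PowerSeries ℤ)
              = X ^ (l+2) * CC ^ (l+3) + X * (X ^ l * CC ^ (l+1)) := by
            have h := CC_eq
            calc (X ^ (l+1) * CC ^ (l+2) : PowerSeries ℤ) = X ^ (l+1) * CC ^ (l+1) * CC := by ring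
              _ = X ^ (l+1) * CC ^ (l+1) * (1 + X * CC ^ 2) := by rw [← h]
              _ = _ := by ring
          rw [e_rec l n hl, id1, map_add, coeff_succ_X_mul, ← ih l, Nat.cast_add,
            ihd (l+1) (by omega)]
        · exact z _ _ (by omega)
    intro l
    cases l with
    | zero =>
      rw [e_zero_succ, main (n+1) 0 (by omega)]
      conv_rhs => rw [zero_add, pow_one, pow_zero, one_mul, CC_eq, map_add]
      simp [coeff_one]
    | succ l => exact main (n+1) l (by omega)

lemma a_one (l n : ℕ) (hl : 1 ≤ l) : a 1 l n = e l n := by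
  unfold a e
  congr! 4 with π
  constructor
  · exact fun h => h.2
  · intro h
    refine ⟨⟨by have := h.1; omega, fun i j hij hj => ?_⟩, h⟩
    have : (i : ℕ) < j := hij
    omega

lemma a_zero_of_lt (k l n : ℕ) (h : n < k ∨ n < l) : a k l n = 0 := by
  unfold a
  have : IsEmpty {π : Equiv.Perm (Fin n) // AvoidsC132 π ∧ BeginsInc π k ∧ EndsInc π l} :=
    ⟨fun x => by have := x.2.2.1.1; have := x.2.2.2.1; omega⟩
  simp

lemma a_diag (k n : ℕ) (h : k ≤ n) : a k n n = 1 := by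
  unfold a
  have mono : ∀ π : Equiv.Perm (Fin n), EndsInc π n → π = 1 := by
    intro π hπ
    have hm : StrictMono π := fun i j hij => hπ.2 i j hij (by omega)
    ext i
    have := Subsingleton.elim (StrictMono.orderIsoOfSurjective π hm π.surjective) (OrderIso.refl _)
    have := congrArg (fun f : Fin n ≃o Fin n => f i) this
    simpa using congrArg Fin.val this
  rw [Nat.card_eq_one_iff_unique]
  refine ⟨⟨fun x y => Subtype.ext ((mono _ x.2.2.2).trans (mono _ y.2.2.2).symm)⟩,
    ⟨1, ?_, ⟨h, ?_⟩, ⟨le_refl _, ?_⟩⟩⟩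
  · rintro ⟨i, j, k, _, h1, _, h2⟩
    exact absurd h1 (not_lt.2 h2.le)
  · intro i j hij _; exact hij
  · intro i j hij _; exact hij

open PowerSeries in
lemma gf_succ (k l : ℕ) (hk : 1 ≤ k) (hl : 1 ≤ l) :
    PowerSeries.mk (fun n => (a (k+1) l n : ℤ))
      = X * PowerSeries.mk (fun n => (a k l n : ℤ)) + (if k + 1 ≤ l then X ^ l else 0) := by
  ext n
  rw [map_add, coeff_mk]
  have hi : coeff n (if k + 1 ≤ l then (X ^ l : PowerSeries ℤ) else 0)
      = if k + 1 ≤ l ∧ n = l then 1 else 0 := by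
    split_ifs <;> simp_all [coeff_X_pow]
  rw [hi]
  cases n with
  | zero =>
    rw [a_zero_of_lt _ _ _ (by omega), if_neg (by omega)]; simp
  | succ n =>
    rw [coeff_succ_X_mul, coeff_mk]
    by_cases h1 : l ≤ n
    · obtain ⟨m, rfl⟩ : ∃ m, n = m + 1 := ⟨n - 1, by omega⟩
      rw [a_succ k l m hk h1, if_neg (by omega)]; simp
    · rw [a_zero_of_lt k l n (by omega)]
      by_cases h2 : k + 1 ≤ l ∧ n + 1 = l
      · rw [if_pos h2, ← h2.2, a_diag _ _ (by omega)]; simp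
      · rw [if_neg h2, a_zero_of_lt _ _ _ (by omega)]; simp

end P132

open PowerSeries in
theorem P132.main (k l : ℕ) (hl : 1 ≤ l) :
    PowerSeries.mk (fun n => (a (k+1) l n : ℤ))
      = PowerSeries.X ^ (k + l) * P132.CC ^ (l + 1)
        + ∑ n ∈ Finset.Ico (max (k+1) l) (k + l), PowerSeries.X ^ n := by
  induction k with
  | zero =>
    rw [Finset.Ico_eq_empty (by simp)]
    ext n
    simp [P132.a_one l n hl, P132.e_eq]
  | succ k ih =>
    rw [P132.gf_succ (k+1) l (by omega) hl, ih, mul_add, Finset.mul_sum]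
    have : ∑ n ∈ Finset.Ico (max (k+1) l) (k + l), (X * X ^ n : PowerSeries ℤ)
        = ∑ n ∈ Finset.Ico (max (k+1) l + 1) (k + l + 1), X ^ n := by
      rw [← Finset.sum_Ico_add']
      simp [pow_succ']
    rw [this, ← mul_assoc, ← pow_succ', show k + 1 + l = k + l + 1 by omega, add_assoc]
    congr 1
    split_ifs with h
    · rw [show max (k+1) l = l by omega, show max (k+1+1) l = l by omega, add_comm,
        ← Finset.sum_eq_sum_Ico_succ_bot (by omega)]
    · rw [show max (k+1) l + 1 = max (k+1+1) l by omega, add_zero]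

theorem avoidC132_beginInc_endInc_gf (k l : ℕ) (hk : 1 ≤ k) (hl : 1 ≤ l) :
    PowerSeries.mk (fun n => (a k l n : ℤ))
      = PowerSeries.X ^ (k + l - 1) * (PowerSeries.mk fun n => (catalan n : ℤ)) ^ (l + 1)
        + ∑ n ∈ Finset.Icc (max k l) (k + l - 2), PowerSeries.X ^ n := by
  obtain ⟨k, rfl⟩ : ∃ k', k = k' + 1 := ⟨k - 1, by omega⟩
  rw [P132.main k l hl, show k + 1 + l - 1 = k + l by omega]
  congr 1
  refine Finset.sum_congr ?_ fun _ _ => rfl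
  ext x
  simp only [Finset.mem_Ico, Finset.mem_Icc]
  omega
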